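/- Let p, q ∈ (1,∞) with 1/p + 1/q = 1, and let A be an entrywise nonnegative M×N real matrix that is not block diagonal, in the sense that every row and every column of A contains a nonzero entry and the bipartite graph on the row and column indices, with an edge between row m and column n whenever A_{mn} > 0, is connected. Then there exist entrywise strictly positive vectors u ∈ ℝ^M and v ∈ ℝ^N such that (Aᵀu)_n = v_n^{q/p} · ‖A‖_{q→q} for all n and (Av)_m = u_m^{p/q} · ‖A‖_{q→q} for all m, where ‖A‖_{q→q} = max_{x≠0} ‖Ax‖_q/‖x‖_q is the induced ℓ^q operator norm. -/

import Mathlib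

/-- The `ℓ^p` norm with a real exponent `p`. -/
noncomputable def lpNormR (p : ℝ) {ι : Type*} [Fintype ι] {E : Type*}
    [SeminormedAddCommGroup E] (v : ι → E) : ℝ :=
  (∑ i, ‖v i‖ ^ p) ^ (1 / p)

/-- The operator norm of a matrix induced by the `ℓ^q` vector norm, real exponent `q`. -/
noncomputable def opNormR (q : ℝ) {m n : Type*} [Fintype m] [Fintype n]
    (A : Matrix m n ℝ) : ℝ :=
  sSup {c : ℝ | ∃ x : n → ℝ, x ≠ 0 ∧ c = lpNormR q (A.mulVec x) / lpNormR q x}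

/-- The adjacency relation of the bipartite graph of the nonzero entries of `A`:
row `m` is adjacent to column `n` exactly when `A m n > 0`. -/
def bipAdj {M N : Type*} (A : Matrix M N ℝ) : M ⊕ N → M ⊕ N → Prop
  | Sum.inl m, Sum.inr n => 0 < A m n
  | Sum.inr n, Sum.inl m => 0 < A m n
  | _, _ => False

/-- A matrix is not block diagonal when every row and every column contains a nonzero
entry and the bipartite graph of its positive entries is connected. -/
def NotBlockDiagonal {M N : Type*} (A : Matrix M N ℝ) : Prop :=
  (∀ m, ∃ n, A m n ≠ 0) ∧ (∀ n, ∃ m, A m n ≠ 0) ∧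
    ∀ x y : M ⊕ N, Relation.ReflTransGen (bipAdj A) x y

/-- A maximizer of the `ℓ^q` quotient with nonnegative entries. -/
theorem aux_exists_max (q : ℝ) (hq : 1 < q) {M N : Type*} [Fintype M] [Fintype N] [Nonempty N]
    (A : Matrix M N ℝ) (hA : ∀ m n, 0 ≤ A m n) :
    ∃ v : N → ℝ, (∀ n, 0 ≤ v n) ∧ ∑ n, |v n| ^ q = 1 ∧
      ∀ x : N → ℝ, ∑ m, |A.mulVec x m| ^ q ≤ (∑ m, |A.mulVec v m| ^ q) * ∑ n, |x n| ^ q := by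
  classical
  have hq0 : 0 < q := by linarith
  have hcont : Continuous fun x : N → ℝ => ∑ n, |x n| ^ q :=
    continuous_finsetSum _ fun n _ => (continuous_apply n).abs.rpow_const fun _ => Or.inr hq0.le
  have hF : Continuous fun x : N → ℝ => ∑ m, |A.mulVec x m| ^ q := by
    refine continuous_finsetSum _ fun m _ => Continuous.rpow_const ?_ fun _ => Or.inr hq0.le
    unfold Matrix.mulVec dotProduct
    fun_prop
  have hclosed : IsClosed {x : N → ℝ | ∑ n, |x n| ^ q = 1} := isClosed_eq hcont continuous_const
  have hcomp : IsCompact {x : N → ℝ | ∑ n, |x n| ^ q = 1} := by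
    refine Metric.isCompact_of_isClosed_isBounded hclosed ?_
    refine (Metric.isBounded_closedBall (x := (0 : N → ℝ)) (r := 1)).subset ?_
    intro x hx
    rw [mem_closedBall_zero_iff, pi_norm_le_iff_of_nonneg zero_le_one]
    intro n
    rw [Real.norm_eq_abs]
    have h1 : |x n| ^ q ≤ 1 := by
      have hx' : ∑ n, |x n| ^ q = 1 := hx
      rw [← hx']
      exact Finset.single_le_sum (f := fun n => |x n| ^ q)
        (fun i _ => Real.rpow_nonneg (abs_nonneg _) _) (Finset.mem_univ n)
    by_contra hlt
    push Not at hlt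
    exact absurd h1 (not_le.mpr (Real.one_lt_rpow hlt hq0))
  obtain ⟨n0⟩ := ‹Nonempty N›
  have hne : {x : N → ℝ | ∑ n, |x n| ^ q = 1}.Nonempty := by
    refine ⟨Pi.single n0 1, ?_⟩
    show ∑ n, |(Pi.single n0 1 : N → ℝ) n| ^ q = 1
    rw [Finset.sum_eq_single n0]
    · simp
    · intro b _ hb
      simp [Pi.single_eq_of_ne hb, Real.zero_rpow hq0.ne']
    · simp
  obtain ⟨x0, hx0, hmax⟩ := hcomp.exists_isMaxOn hne hF.continuousOn
  have hx0' : ∑ n, |x0 n| ^ q = 1 := hx0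
  refine ⟨fun n => |x0 n|, fun n => abs_nonneg _, by simpa using hx0', ?_⟩
  have hle : ∑ m, |A.mulVec x0 m| ^ q ≤ ∑ m, |A.mulVec (fun n => |x0 n|) m| ^ q := by
    refine Finset.sum_le_sum fun m _ => Real.rpow_le_rpow (abs_nonneg _) ?_ hq0.le
    refine le_trans ?_ (le_abs_self _)
    unfold Matrix.mulVec dotProduct
    refine (Finset.abs_sum_le_sum_abs _ _).trans (Finset.sum_le_sum fun n _ => ?_)
    rw [abs_mul, abs_of_nonneg (hA m n)]
  intro x
  set S := ∑ n, |x n| ^ q with hS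
  have hS0 : 0 ≤ S := Finset.sum_nonneg fun n _ => Real.rpow_nonneg (abs_nonneg _) _
  rcases hS0.eq_or_lt with h0 | hpos
  · have hx : x = 0 := by
      funext n
      have := (Finset.sum_eq_zero_iff_of_nonneg
        (fun n _ => Real.rpow_nonneg (abs_nonneg (x n)) q)).1 h0.symm n (Finset.mem_univ n)
      rw [Real.rpow_eq_zero (abs_nonneg _) hq0.ne'] at this
      simpa using this
    rw [← h0, hx]
    simp [Real.zero_rpow hq0.ne']
  · set c : ℝ := S ^ (-(1 / q)) with hc
    have hc0 : 0 < c := Real.rpow_pos_of_pos hpos _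
    have hcq : c ^ q = S⁻¹ := by
      rw [hc, ← Real.rpow_mul hpos.le, neg_mul, one_div_mul_cancel hq0.ne', Real.rpow_neg_one]
    have hcx : (c • x) ∈ {x : N → ℝ | ∑ n, |x n| ^ q = 1} := by
      show ∑ n, |(c • x) n| ^ q = 1
      simp only [Pi.smul_apply, smul_eq_mul, abs_mul, abs_of_pos hc0,
        Real.mul_rpow hc0.le (abs_nonneg _)]
      rw [← Finset.mul_sum, hcq, ← hS, inv_mul_cancel₀ hpos.ne']
    have h2 : ∑ m, |A.mulVec (c • x) m| ^ q ≤ ∑ m, |A.mulVec x0 m| ^ q := hmax hcx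
    simp only [Matrix.mulVec_smul, Pi.smul_apply, smul_eq_mul, abs_mul, abs_of_pos hc0,
        Real.mul_rpow hc0.le (abs_nonneg _)] at h2
    rw [← Finset.mul_sum, hcq, inv_mul_le_iff₀ hpos] at h2
    rw [mul_comm]
    exact h2.trans (mul_le_mul_of_nonneg_left hle hpos.le)

theorem aux_abs_rpow (q y : ℝ) (hq : 1 < q) (hy : 0 ≤ y) : |y| ^ (q - 2) * y = y ^ (q - 1) := by
  rw [abs_of_nonneg hy]
  rcases hy.eq_or_lt with h | h
  · rw [← h, mul_zero, Real.zero_rpow (by linarith)]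
  · rw [← Real.rpow_add_one h.ne']
    congr 1
    ring

/-- Stationarity at the maximizer. -/
theorem aux_stationary (q : ℝ) (hq : 1 < q) {M N : Type*} [Fintype M] [Fintype N]
    (A : Matrix M N ℝ) (hA : ∀ m n, 0 ≤ A m n) (v : N → ℝ) (hv : ∀ n, 0 ≤ v n) (L : ℝ)
    (hL : ∑ m, |A.mulVec v m| ^ q = L * ∑ n, |v n| ^ q)
    (hle : ∀ x : N → ℝ, ∑ m, |A.mulVec x m| ^ q ≤ L * ∑ n, |x n| ^ q) (n : N) :
    ∑ m, A m n * (A.mulVec v m) ^ (q - 1) = L * v n ^ (q - 1) := by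
  classical
  have hy : ∀ m, 0 ≤ A.mulVec v m := fun m =>
    Finset.sum_nonneg fun n _ => mul_nonneg (hA m n) (hv n)
  let e : N → ℝ := Pi.single n 1
  have hd1 : ∀ a b : ℝ, HasDerivAt (fun t : ℝ => |a + t * b| ^ q)
      (q * |a| ^ (q - 2) * a * b) 0 := by
    intro a b
    have h1 : HasDerivAt (fun t : ℝ => a + t * b) b 0 := by
      simpa using ((hasDerivAt_id (0 : ℝ)).mul_const b).const_add a
    have h2 := hasDerivAt_abs_rpow (a + 0 * b) hq
    have h3 := HasDerivAt.comp (0 : ℝ) h2 h1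
    simpa [Function.comp_def] using h3
  have hd : HasDerivAt (fun t : ℝ => ∑ m, |A.mulVec v m + t * A m n| ^ q
      - L * ∑ k, |v k + t * e k| ^ q)
      (∑ m, q * |A.mulVec v m| ^ (q - 2) * A.mulVec v m * A m n
        - L * ∑ k, q * |v k| ^ (q - 2) * v k * e k) 0 :=
    (HasDerivAt.fun_sum fun m _ => hd1 _ _).sub
      ((HasDerivAt.fun_sum fun k _ => hd1 _ _).const_mul L)
  have hmul : ∀ t : ℝ, ∀ m, A.mulVec (v + t • e) m = A.mulVec v m + t * A m n := by
    intro t m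
    simp [Matrix.mulVec_add, Matrix.mulVec_smul, e]
  have hmax : IsLocalMax (fun t : ℝ => ∑ m, |A.mulVec v m + t * A m n| ^ q
      - L * ∑ k, |v k + t * e k| ^ q) 0 := by
    refine Filter.Eventually.of_forall fun t => ?_
    have h := hle (v + t • e)
    simp only [hmul, Pi.add_apply, Pi.smul_apply, smul_eq_mul] at h
    simp only [zero_mul, add_zero]
    linarith
  have h0 := hmax.hasDerivAt_eq_zero hd
  have hs : ∑ k, q * |v k| ^ (q - 2) * v k * e k = q * v n ^ (q - 1) := by
    rw [Finset.sum_eq_single n]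
    · simp [e, mul_assoc, aux_abs_rpow q _ hq (hv n)]
    · intro b _ hb
      simp [e, Pi.single_eq_of_ne hb]
    · simp
  have hs2 : ∑ m, q * |A.mulVec v m| ^ (q - 2) * A.mulVec v m * A m n
      = q * ∑ m, A m n * (A.mulVec v m) ^ (q - 1) := by
    rw [Finset.mul_sum]
    refine Finset.sum_congr rfl fun m _ => ?_
    rw [← aux_abs_rpow q _ hq (hy m)]
    ring
  rw [hs, hs2] at h0
  have hq0 : q ≠ 0 := by linarith
  apply mul_left_cancel₀ hq0
  linarith

/-- Generalized singular vectors of a nonnegative, not block diagonal matrix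
(Theorem `thm:uAv_pos_noblock` of the paper): for conjugate exponents `p, q ∈ (1,∞)`
there are entrywise strictly positive `u`, `v` with `(Aᵀu)_n = v_n^(q/p) ⬝ ‖A‖_{q→q}`
and `(Av)_m = u_m^(p/q) ⬝ ‖A‖_{q→q}`. -/
theorem stmt16 (p q : ℝ) (hp : 1 < p) (hq : 1 < q) (hpq : 1 / p + 1 / q = 1)
    {M N : Type*} [Fintype M] [Fintype N]
    (A : Matrix M N ℝ) (hA : ∀ m n, 0 ≤ A m n) (hnb : NotBlockDiagonal A) :
    ∃ (u : M → ℝ) (v : N → ℝ), (∀ m, 0 < u m) ∧ (∀ n, 0 < v n) ∧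
      (∀ n, A.transpose.mulVec u n = v n ^ (q / p) * opNormR q A) ∧
      (∀ m, A.mulVec v m = u m ^ (p / q) * opNormR q A) := by
  have hp0 : 0 < p := by linarith
  have hq0 : 0 < q := by linarith
  have hadd : q + p = p * q := by
    field_simp at hpq
    linarith
  have hqp : q / p = q - 1 := by
    rw [div_eq_iff hp0.ne']
    linarith
  have hpq' : (q - 1) * (p / q) = 1 := by
    rw [← hqp]
    field_simp
  obtain ⟨hrow, hcol, hconn⟩ := hnb
  rcases isEmpty_or_nonempty N with hN | hN
  · have hM : IsEmpty M := ⟨fun m => hN.elim (hrow m).choose⟩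
    exact ⟨fun _ => 1, fun _ => 1, fun m => hM.elim m, fun n => hN.elim n,
      fun n => hN.elim n, fun m => hM.elim m⟩
  obtain ⟨v, hv, hv1, hle⟩ := aux_exists_max q hq A hA
  set L := ∑ m, |A.mulVec v m| ^ q with hLdef
  have hst := aux_stationary q hq A hA v hv L (by rw [hv1, mul_one]) hle
  have hy : ∀ m, 0 ≤ A.mulVec v m := fun m =>
    Finset.sum_nonneg fun n _ => mul_nonneg (hA m n) (hv n)
  have hyle : ∀ m n, A m n * v n ≤ A.mulVec v m := fun m n =>
    Finset.single_le_sum (f := fun n => A m n * v n)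
      (fun i _ => mul_nonneg (hA m i) (hv i)) (Finset.mem_univ n)
  -- positivity of `v`
  have hvpos : ∀ n, 0 < v n := by
    intro n
    refine (hv n).lt_of_ne fun h0 => ?_
    have key : ∀ z : M ⊕ N, Relation.ReflTransGen (bipAdj A) (Sum.inr n) z →
        Sum.elim (fun m => A.mulVec v m) v z = 0 := by
      intro z hz
      induction hz with
      | refl => exact h0.symm
      | @tail b c _ hbc ih =>
        rcases b with m | k <;> rcases c with m' | k'
        · exact hbc.elim
        · have hA0 : 0 < A m k' := hbc
          have ih' : A.mulVec v m = 0 := ih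
          have h1 := hyle m k'
          rw [ih'] at h1
          show v k' = 0
          have h2 : A m k' * v k' = 0 := le_antisymm h1 (mul_nonneg hA0.le (hv k'))
          exact (mul_eq_zero.1 h2).resolve_left hA0.ne'
        · have hA0 : 0 < A m' k := hbc
          have ih' : v k = 0 := ih
          have h1 := hst k
          rw [ih', Real.zero_rpow (by linarith), mul_zero] at h1
          have h2 := (Finset.sum_eq_zero_iff_of_nonneg (fun m _ =>
            mul_nonneg (hA m k) (Real.rpow_nonneg (hy m) _))).1 h1 m' (Finset.mem_univ m')
          have h3 := (mul_eq_zero.1 h2).resolve_left hA0.ne'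
          exact (Real.rpow_eq_zero (hy m') (by linarith)).1 h3
        · exact hbc.elim
    have hz : ∀ k, v k = 0 := fun k => key (Sum.inr k) (hconn _ _)
    simp [hz, Real.zero_rpow hq0.ne'] at hv1
  have hypos : ∀ m, 0 < A.mulVec v m := by
    intro m
    obtain ⟨n, hn⟩ := hrow m
    exact (mul_pos ((hA m n).lt_of_ne' hn) (hvpos n)).trans_le (hyle m n)
  have hLpos : 0 < L := by
    obtain ⟨n⟩ := hN
    obtain ⟨m, _⟩ := hcol n
    have h1 : |A.mulVec v m| ^ q ≤ L := Finset.single_le_sum (f := fun m => |A.mulVec v m| ^ q)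
      (fun i _ => Real.rpow_nonneg (abs_nonneg _) _) (Finset.mem_univ m)
    exact (Real.rpow_pos_of_pos (abs_pos.2 (hypos m).ne') _).trans_le h1
  have hop : opNormR q A = L ^ (1 / q) := by
    unfold opNormR
    refine IsGreatest.csSup_eq ⟨⟨v, ?_, ?_⟩, ?_⟩
    · intro h
      obtain ⟨n⟩ := hN
      exact (hvpos n).ne' (congrFun h n)
    · unfold lpNormR
      simp only [Real.norm_eq_abs]
      rw [hv1, Real.one_rpow, div_one]
    · rintro c ⟨x, hx, rfl⟩
      unfold lpNormR
      simp only [Real.norm_eq_abs]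
      have hS : 0 ≤ ∑ n, |x n| ^ q :=
        Finset.sum_nonneg fun n _ => Real.rpow_nonneg (abs_nonneg _) _
      refine div_le_of_le_mul₀ (Real.rpow_nonneg hS _) (Real.rpow_nonneg hLpos.le _) ?_
      rw [← Real.mul_rpow hLpos.le hS]
      exact Real.rpow_le_rpow
        (Finset.sum_nonneg fun n _ => Real.rpow_nonneg (abs_nonneg _) _) (hle x) (by positivity)
  set K := opNormR q A with hK
  have hKpos : 0 < K := by
    rw [hop]
    exact Real.rpow_pos_of_pos hLpos _
  have hKq : L = K * K ^ (q - 1) := by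
    rw [mul_comm, ← Real.rpow_add_one hKpos.ne', sub_add_cancel, hop, ← Real.rpow_mul hLpos.le,
      one_div_mul_cancel hq0.ne', Real.rpow_one]
  refine ⟨fun m => (A.mulVec v m / K) ^ (q - 1), v,
    fun m => Real.rpow_pos_of_pos (div_pos (hypos m) hKpos) _, hvpos, ?_, ?_⟩
  · intro n
    have hKp : 0 < K ^ (q - 1) := Real.rpow_pos_of_pos hKpos _
    have h1 : A.transpose.mulVec (fun m => (A.mulVec v m / K) ^ (q - 1)) n
        = (∑ m, A m n * (A.mulVec v m) ^ (q - 1)) / K ^ (q - 1) := by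
      rw [Finset.sum_div]
      refine Finset.sum_congr rfl fun m _ => ?_
      show A m n * (A.mulVec v m / K) ^ (q - 1) = _
      rw [Real.div_rpow (hy m) hKpos.le, mul_div_assoc]
    rw [h1, hst n, hqp, div_eq_iff hKp.ne', hKq]
    ring
  · intro m
    show A.mulVec v m = ((A.mulVec v m / K) ^ (q - 1)) ^ (p / q) * K
    rw [← Real.rpow_mul (div_pos (hypos m) hKpos).le, hpq', Real.rpow_one,
      div_mul_cancel₀ _ hKpos.ne']
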